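/- Let g be a probability density on ℝ and let f_{μ,σ}(y) = (1/σ) g((y−μ)/σ) be its location-scale family. Suppose: (i) g is absolutely continuous; (ii) g has an almost-everywhere derivative ġ; (iii) the function ξ̇_{(μ,1)_μ}(y) := −(1/2) ġ(y−μ) 1{g(y−μ) > 0} / √(g(y−μ)) is square integrable and ∫ ξ̇²_{(μ,1)_μ}(y) dy → ∫ ξ̇²_{(0,1)_μ}(y) dy as μ → 0; (iv) y ξ̇_{(0,1)_μ}(y) is square integrable; (v) ‖ξ̇_{(0,σ)_μ} − ξ̇_{(0,1)_μ}‖_{L²} = O(|σ−1|) as σ → 1. Then the family {f_{μ,σ}} is Hellinger differentiable at (μ,σ) = (0,1) with Hellinger derivative (ξ̇_{(0,1)_μ}(y), ξ̇_{(0,1)_σ}(y)), where ξ̇_{(0,1)_σ}(y) := −(1/2)√(g(y)) − (y/2) ġ(y) 1{g(y)>0} / √(g(y)). -/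

import Mathlib

open MeasureTheory Filter Asymptotics Topology

/-- The location-scale family `f_{μ,σ}(y) = (1/σ) g((y-μ)/σ)`. -/
noncomputable def locScale (g : ℝ → ℝ) (μ σ : ℝ) : ℝ → ℝ := fun y => σ⁻¹ * g ((y - μ) / σ)

/-- The `L²(ℝ)` norm of a function (with respect to Lebesgue measure). -/
noncomputable def l2norm (r : ℝ → ℝ) : ℝ := Real.sqrt (∫ y, (r y) ^ 2)

/-- Hellinger differentiability at `(μ,σ) = (0,1)` of the location-scale family of `g`,
with derivative vector `(ξμ, ξσ)` of square-integrable functions and `L²` remainder of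
order `o(|θ - (0,1)|)`. -/
def HellingerDiffAt (g : ℝ → ℝ) (ξμ ξσ : ℝ → ℝ) : Prop :=
  Integrable (fun y => (ξμ y) ^ 2) ∧ Integrable (fun y => (ξσ y) ^ 2) ∧
  (fun θ : ℝ × ℝ => l2norm (fun y =>
      Real.sqrt (locScale g θ.1 θ.2 y) - Real.sqrt (g y) - θ.1 * ξμ y - (θ.2 - 1) * ξσ y))
    =o[𝓝 ((0 : ℝ), (1 : ℝ))] (fun θ : ℝ × ℝ => ‖θ - ((0 : ℝ), (1 : ℝ))‖)

/-- The candidate location Hellinger derivative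
`ξ̇_{(μ,1)_μ}(y) = -(1/2) ġ(y-μ) 1{g(y-μ)>0} / √(g(y-μ))`. -/
noncomputable def xiMuLoc (g gdot : ℝ → ℝ) (μ : ℝ) : ℝ → ℝ := fun y =>
  -(1 / 2) * gdot (y - μ) * (if 0 < g (y - μ) then 1 else 0) / Real.sqrt (g (y - μ))

/-- The candidate location Hellinger derivative at `(0,σ)`:
`ξ̇_{(0,σ)_μ}(y) = -(1/(2σ^{3/2})) ġ(y/σ) 1{g(y/σ)>0} / √(g(y/σ))`. -/
noncomputable def xiMuScale (g gdot : ℝ → ℝ) (σ : ℝ) : ℝ → ℝ := fun y =>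
  -(1 / (2 * σ ^ ((3 : ℝ) / 2))) * gdot (y / σ) *
    (if 0 < g (y / σ) then 1 else 0) / Real.sqrt (g (y / σ))

/-- The candidate scale Hellinger derivative at `(0,1)`:
`ξ̇_{(0,1)_σ}(y) = -(1/2)√(g(y)) - (y/2) ġ(y) 1{g(y)>0}/√(g(y))`. -/
noncomputable def xiSigma (g gdot : ℝ → ℝ) : ℝ → ℝ := fun y =>
  -(1 / 2) * Real.sqrt (g y) - (y / 2) * gdot y * (if 0 < g y then 1 else 0) / Real.sqrt (g y)

lemma aux_locInt (g gdot : ℝ → ℝ) (hg_int : ∫ y, g y = 1)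
    (hAC : ∀ a b : ℝ, g b - g a = ∫ y in a..b, gdot y) :
    LocallyIntegrable gdot := by
  have hgi : Integrable g := by
    by_contra h
    rw [integral_undef h] at hg_int
    exact zero_ne_one hg_int
  by_contra hc
  unfold LocallyIntegrable at hc
  push Not at hc
  obtain ⟨c, hc⟩ := hc
  have hni : ∀ a b : ℝ, a < c → c < b → ¬ IntervalIntegrable gdot volume a b := by
    intro a b ha hb hi
    apply hc
    refine ⟨Set.Ioc a b, Ioc_mem_nhds ha hb, ?_⟩
    rwa [intervalIntegrable_iff_integrableOn_Ioc_of_le (ha.trans hb).le] at hi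
  have heq : ∀ a b : ℝ, a < c → c < b → g b = g a := by
    intro a b ha hb
    have := hAC a b
    rw [intervalIntegral.integral_undef (hni a b ha hb)] at this
    linarith
  have hconst : ∀ y, y ≠ c → g y = g (c+1) := by
    intro y hy
    rcases lt_or_gt_of_ne hy with h | h
    · exact (heq y (c+1) h (by linarith)).symm
    · rw [heq (c-1) y (by linarith) h, heq (c-1) (c+1) (by linarith) (by linarith)]
  have hae : g =ᵐ[volume] fun _ => g (c+1) := by
    have : ∀ᵐ y : ℝ, y ≠ c := by simp [ae_iff, measure_singleton]
    filter_upwards [this] with y hy using hconst y hy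
  have h1 := (integrable_congr hae).1 hgi
  rw [integral_congr_ae hae] at hg_int
  rw [integrable_const_iff] at h1
  rcases h1 with h1 | h1
  · simp [h1] at hg_int
  · exact absurd h1.1 (by simp)

lemma aux_intInt {f : ℝ → ℝ} (hf : LocallyIntegrable f) (a b : ℝ) :
    IntervalIntegrable f volume a b :=
  intervalIntegrable_iff.mpr <|
      (hf.integrableOn_isCompact isCompact_uIcc).mono_set Set.uIoc_subset_uIcc

lemma aux_lip_comp {f φ : ℝ → ℝ} {a b K : ℝ} (hf : AbsolutelyContinuousOnInterval f a b)
    (hφ : ∀ x y, |φ (f x) - φ (f y)| ≤ K * |f x - f y|) :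
    AbsolutelyContinuousOnInterval (fun x => φ (f x)) a b := by
  unfold AbsolutelyContinuousOnInterval at *
  apply squeeze_zero (fun t ↦ ?_) (fun t ↦ ?_) (by simpa using hf.const_mul K)
  · exact Finset.sum_nonneg (fun i hi ↦ by positivity)
  · rw [Finset.mul_sum]
    gcongr
    exact hφ _ _

lemma aux_sqrt_lip {ε x y : ℝ} (hε : 0 < ε) (hx : 0 ≤ x) (hy : 0 ≤ y) :
    |√(x+ε) - √(y+ε)| ≤ (√ε)⁻¹ * |x - y| := by
  have h1 : 0 < √ε := Real.sqrt_pos.2 hε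
  have h2 : √ε ≤ √(x+ε) := Real.sqrt_le_sqrt (by linarith)
  have h3 : 0 ≤ √(y+ε) := Real.sqrt_nonneg _
  have h4 : (√(x+ε) - √(y+ε)) * (√(x+ε) + √(y+ε)) = x - y := by
    have e1 := Real.mul_self_sqrt (show 0 ≤ x + ε by linarith)
    have e2 := Real.mul_self_sqrt (show 0 ≤ y + ε by linarith)
    linarith [mul_comm (√(x+ε)) (√(y+ε))]
  rw [← h4, abs_mul, abs_of_nonneg (show 0 ≤ √(x+ε) + √(y+ε) by linarith)]
  rw [inv_mul_eq_div, le_div_iff₀ h1]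
  gcongr
  linarith

lemma aux_sqrt_ftc (g h : ℝ → ℝ) (hg_nonneg : ∀ y, 0 ≤ g y) (hgl : LocallyIntegrable (deriv g))
    (hAC : ∀ a b : ℝ, g b - g a = ∫ y in a..b, deriv g y)
    (hd : ∀ᵐ y : ℝ, DifferentiableAt ℝ g y)
    (hh : ∀ y, h y = (1/2) * deriv g y * (if 0 < g y then 1 else 0) / √(g y))
    (hhl : LocallyIntegrable h) (a b : ℝ) :
    √(g b) - √(g a) = ∫ y in a..b, h y := by
  have hgac : ∀ a b, AbsolutelyContinuousOnInterval g a b := by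
    intro a b
    have h1 : g = fun x => (fun x => ∫ y in a..x, deriv g y) x + (fun _ => g a) x := by
      funext x; simp [← hAC]
    rw [h1]
    refine AbsolutelyContinuousOnInterval.add (f := fun x => ∫ y in a..x, deriv g y) (g := fun _ => g a) ?_ ?_
    · exact (aux_intInt hgl a b).absolutelyContinuousOnInterval_intervalIntegral (by simp)
    · exact (LipschitzOnWith.absolutelyContinuousOnInterval (K := 0) ((LipschitzWith.const _).lipschitzOnWith))
  have hcont : Continuous g := by
    rw [continuous_iff_continuousAt]
    intro x
    have := (hgac (x-1) (x+1)).continuousOn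
    rw [Set.uIcc_of_le (by linarith)] at this
    exact this.continuousAt (Icc_mem_nhds (by linarith) (by linarith))
  have hε : ∀ n : ℕ, (0:ℝ) < 1 / ((n:ℝ)+1) := fun n => by positivity
  have key : ∀ n : ℕ, ∫ y in a..b, deriv g y / (2 * √(g y + 1 / ((n:ℝ)+1))) =
      √(g b + 1 / ((n:ℝ)+1)) - √(g a + 1 / ((n:ℝ)+1)) := by
    intro n
    have hac : AbsolutelyContinuousOnInterval (fun x => √(g x + 1 / ((n:ℝ)+1))) a b :=
      aux_lip_comp (φ := fun x => √(x + 1 / ((n:ℝ)+1))) (hgac a b)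
        (fun x y => aux_sqrt_lip (hε n) (hg_nonneg x) (hg_nonneg y))
    rw [← hac.integral_deriv_eq_sub]
    apply intervalIntegral.integral_congr_ae
    filter_upwards [hd] with y hy _
    have := (hy.hasDerivAt.add_const (1 / ((n:ℝ)+1))).sqrt (by have := hg_nonneg y; have := hε n; positivity)
    rw [this.deriv]
  have hlim0 : Tendsto (fun n : ℕ => 1 / ((n:ℝ)+1)) atTop (𝓝 0) := tendsto_one_div_add_atTop_nhds_zero_nat
  have hs : ∀ x, Tendsto (fun n : ℕ => √(g x + 1 / ((n:ℝ)+1))) atTop (𝓝 (√(g x))) := by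
    intro x
    have : Tendsto (fun n : ℕ => g x + 1 / ((n:ℝ)+1)) atTop (𝓝 (g x)) := by
      simpa using hlim0.const_add (g x)
    exact this.sqrt
  have hL := (hs b).sub (hs a)
  refine tendsto_nhds_unique hL ?_
  simp_rw [← key]
  have hz : ∀ᵐ y : ℝ, g y = 0 → deriv g y = 0 := by
    refine Eventually.of_forall (fun y hy => ?_)
    have : IsLocalMin g y := Eventually.of_forall (fun z => by rw [hy]; exact hg_nonneg z)
    exact this.deriv_eq_zero
  apply intervalIntegral.tendsto_integral_filter_of_dominated_convergence (fun y => |h y|)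
  · refine Eventually.of_forall (fun n => Measurable.aestronglyMeasurable ?_)
    exact (measurable_deriv g).div ((by fun_prop : Measurable fun y => 2 * √(g y + 1 / ((n:ℝ)+1))))
  · refine Eventually.of_forall (fun n => ?_)
    filter_upwards [hz] with y hy _
    rw [hh]
    rcases (hg_nonneg y).eq_or_lt with h0 | h0
    · simp [hy h0.symm]
    · have h1 : 0 < √(g y) := Real.sqrt_pos.2 h0
      have h2 : √(g y) ≤ √(g y + 1 / ((n:ℝ)+1)) := Real.sqrt_le_sqrt (by linarith [hε n])
      simp only [h0, if_true, mul_one, Real.norm_eq_abs, abs_div, abs_mul]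
      rw [abs_of_pos (h1.trans_le h2), abs_of_pos h1]
      have : |(1:ℝ)| / |2| * |deriv g y| / √(g y) = |deriv g y| / (2 * √(g y)) := by
        norm_num; field_simp
      rw [this, abs_of_pos (show (0:ℝ) < 2 by norm_num)]
      gcongr
  · exact (aux_intInt hhl a b).abs
  · filter_upwards [hz] with y hy _
    rw [hh]
    rcases (hg_nonneg y).eq_or_lt with h0 | h0
    · simp [hy h0.symm]
    · have h1 : 0 < √(g y) := Real.sqrt_pos.2 h0
      have : (1/2) * deriv g y * (if 0 < g y then 1 else 0) / √(g y) = deriv g y / (2 * √(g y)) := by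
        simp only [h0, if_true]; field_simp
      rw [this]
      exact tendsto_const_nhds.div ((hs y).const_mul 2) (by positivity)

lemma aux_cov (h m m' : ℝ → ℝ) (hhl : LocallyIntegrable h)
    (hm : ∀ r ∈ Set.Icc (0:ℝ) 1, HasDerivAt m (m' r) r)
    (hsign : (∀ r ∈ Set.Icc (0:ℝ) 1, 0 ≤ m' r) ∨ (∀ r ∈ Set.Icc (0:ℝ) 1, m' r ≤ 0)) 
    (r : ℝ) (hr : r ∈ Set.Icc (0:ℝ) 1) :
    IntervalIntegrable (fun u => (h ∘ m) u * m' u) volume 0 r ∧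
    ∫ u in (0:ℝ)..r, (h ∘ m) u * m' u = ∫ x in m 0..m r, h x := by
  have hsub : Set.uIcc 0 r ⊆ Set.Icc 0 1 := by
    rw [Set.uIcc_of_le hr.1]; exact Set.Icc_subset_Icc le_rfl hr.2
  have hsub' : ∀ x ∈ Set.Ioo (min 0 r) (max 0 r), x ∈ Set.Icc (0:ℝ) 1 := fun x hx =>
    hsub ⟨hx.1.le, hx.2.le⟩
  have hc : ContinuousOn m (Set.uIcc 0 r) := fun x hx =>
    (hm x (hsub hx)).continuousAt.continuousWithinAt
  rcases hsign with hs | hs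
  · exact ⟨(intervalIntegral.integrable_comp_mul_deriv_iff_of_deriv_nonneg hc
        (fun x hx => hm x (hsub' x hx)) (fun x hx => hs x (hsub' x hx))).2 (aux_intInt hhl _ _),
      intervalIntegral.integral_comp_mul_deriv_of_deriv_nonneg hc
        (fun x hx => hm x (hsub' x hx)) (fun x hx => hs x (hsub' x hx))⟩
  · exact ⟨(intervalIntegral.integrable_comp_mul_deriv_iff_of_deriv_nonpos hc
        (fun x hx => hm x (hsub' x hx)) (fun x hx => hs x (hsub' x hx))).2 (aux_intInt hhl _ _),
      intervalIntegral.integral_comp_mul_deriv_of_deriv_nonpos hc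
        (fun x hx => hm x (hsub' x hx)) (fun x hx => hs x (hsub' x hx))⟩

lemma aux_pos {δ r : ℝ} (hr : r ∈ Set.Icc (0:ℝ) 1) : 1 - |δ| ≤ 1 + r * δ := by
  have h1 : |r * δ| ≤ |δ| := by
    rw [abs_mul, abs_of_nonneg hr.1]
    exact mul_le_of_le_one_left (abs_nonneg _) hr.2
  linarith [neg_abs_le (r * δ)]

lemma aux_path (s h : ℝ → ℝ) (hhl : LocallyIntegrable h)
    (hs : ∀ a b : ℝ, s b - s a = ∫ y in a..b, h y) (μ δ y : ℝ) (hδ : |δ| < 1) :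
    (√(1+δ))⁻¹ * s ((y-μ)/(1+δ)) - s y = ∫ r in (0:ℝ)..1, -((1+r*δ)⁻¹ * (√(1+r*δ))⁻¹ *
      (μ * h ((y-r*μ)/(1+r*δ)) + δ * (s ((y-r*μ)/(1+r*δ)) / 2 +
        ((y-r*μ)/(1+r*δ)) * h ((y-r*μ)/(1+r*δ))))) := by
  set m : ℝ → ℝ := fun r => (y-r*μ)/(1+r*δ) with hmdef
  set m' : ℝ → ℝ := fun r => -(μ+δ*y)/(1+r*δ)^2 with hm'def
  set p : ℝ → ℝ := fun r => (√(1+r*δ))⁻¹ with hpdef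
  set p' : ℝ → ℝ := fun r => -(δ/2) * ((1+r*δ)⁻¹ * (√(1+r*δ))⁻¹) with hp'def
  have hpos : ∀ r ∈ Set.Icc (0:ℝ) 1, 0 < 1 + r*δ := fun r hr => by
    linarith [aux_pos (δ := δ) hr]
  have hu01 : Set.uIcc (0:ℝ) 1 = Set.Icc 0 1 := Set.uIcc_of_le zero_le_one
  have hd1 : ∀ r, HasDerivAt (fun r : ℝ => 1+r*δ) δ r := fun r => by
    simpa using ((hasDerivAt_id r).mul_const δ).const_add 1
  have hm : ∀ r ∈ Set.Icc (0:ℝ) 1, HasDerivAt m (m' r) r := by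
    intro r hr
    have h1 : HasDerivAt (fun r : ℝ => y-r*μ) (-μ) r := by
      simpa using ((hasDerivAt_id r).mul_const μ).const_sub y
    have := h1.div (hd1 r) (hpos r hr).ne'
    refine this.congr_deriv ?_
    change _ = -(μ+δ*y)/(1+r*δ)^2
    congr 1; ring
  have hp : ∀ r ∈ Set.Icc (0:ℝ) 1, HasDerivAt p (p' r) r := by
    intro r hr
    have h0 := hpos r hr
    have := ((hd1 r).sqrt h0.ne').inv (Real.sqrt_pos.2 h0).ne'
    refine this.congr_deriv ?_
    change _ = -(δ/2) * ((1+r*δ)⁻¹ * (√(1+r*δ))⁻¹)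
    rw [Real.sq_sqrt h0.le]
    have := Real.sqrt_pos.2 h0
    field_simp
  have hsign : (∀ r ∈ Set.Icc (0:ℝ) 1, 0 ≤ m' r) ∨ (∀ r ∈ Set.Icc (0:ℝ) 1, m' r ≤ 0) := by
    rcases le_total 0 (-(μ+δ*y)) with h | h
    · left; intro r _; exact div_nonneg h (sq_nonneg _)
    · right; intro r _; exact div_nonpos_of_nonpos_of_nonneg h (sq_nonneg _)
  have hcov := aux_cov h m m' hhl hm hsign
  set F : ℝ → ℝ := fun r => s y + ∫ u in (0:ℝ)..r, (h ∘ m) u * m' u with hF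
  have hm0 : m 0 = y := by simp [hmdef]
  have hFs : ∀ r ∈ Set.Icc (0:ℝ) 1, F r = s (m r) := by
    intro r hr
    simp only [hF]
    rw [(hcov r hr).2, ← hs, hm0]; ring
  have hint := (hcov 1 (by simp)).1
  have hFac : AbsolutelyContinuousOnInterval F 0 1 := by
    refine AbsolutelyContinuousOnInterval.add (f := fun _ => s y)
      (g := fun r => ∫ u in (0:ℝ)..r, (h ∘ m) u * m' u) ?_ ?_
    · exact (LipschitzOnWith.absolutelyContinuousOnInterval (K := 0)
        ((LipschitzWith.const _).lipschitzOnWith))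
    · exact hint.absolutelyContinuousOnInterval_intervalIntegral (by simp)
  have hFd : ∀ᵐ r, r ∈ Set.uIcc (0:ℝ) 1 → HasDerivAt F ((h ∘ m) r * m' r) r := by
    filter_upwards [hint.ae_hasDerivAt_integral] with r hr hr1
    exact (hr hr1 0 (by simp)).const_add (s y)
  have hp'c : ContinuousOn p' (Set.Icc 0 1) := by
    have c1 : ContinuousOn (fun r : ℝ => 1 + r * δ) (Set.Icc 0 1) := by fun_prop
    have c2 : ContinuousOn (fun r : ℝ => √(1 + r * δ)) (Set.Icc 0 1) := by fun_prop
    exact continuousOn_const.mul ((c1.inv₀ (fun r hr => (hpos r hr).ne')).mul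
      (c2.inv₀ (fun r hr => (Real.sqrt_pos.2 (hpos r hr)).ne')))
  have hpac : AbsolutelyContinuousOnInterval p 0 1 := by
    obtain ⟨C, hC⟩ := isCompact_Icc.exists_bound_of_continuousOn hp'c
    apply LipschitzOnWith.absolutelyContinuousOnInterval (K := C.toNNReal)
    rw [hu01]
    refine (convex_Icc 0 1).lipschitzOnWith_of_nnnorm_hasDerivWithin_le
      (fun x hx => (hp x hx).hasDerivWithinAt) (fun x hx => ?_)
    rw [← NNReal.coe_le_coe]
    exact (hC x hx).trans (Real.le_coe_toNNReal C)
  have key := hpac.integral_deriv_mul_eq_sub hFac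
  rw [hFs 1 (by simp), hFs 0 (by simp), hm0] at key
  have e1 : p 0 = 1 := by simp [hpdef]
  have e2 : p 1 = (√(1+δ))⁻¹ := by simp [hpdef]
  have e3 : m 1 = (y-μ)/(1+δ) := by simp [hmdef]
  rw [e1, e2, e3, one_mul] at key
  rw [← key]
  apply intervalIntegral.integral_congr_ae
  filter_upwards [hFd] with r hr hr1
  have hr1' : r ∈ Set.uIcc (0:ℝ) 1 := Set.uIoc_subset_uIcc hr1
  have hr2 : r ∈ Set.Icc (0:ℝ) 1 := hu01 ▸ hr1'
  rw [(hr hr1').deriv, (hp r hr2).deriv, hFs r hr2]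
  have h0 := hpos r hr2
  have h0' := Real.sqrt_pos.2 h0
  have em : m' r = -(1+r*δ)⁻¹ * (μ + δ * m r) := by
    change -(μ+δ*y)/(1+r*δ)^2 = -(1+r*δ)⁻¹ * (μ + δ * ((y-r*μ)/(1+r*δ)))
    have h1 := h0.ne'
    generalize hS : 1 + r * δ = S at *
    have : μ + δ * ((y-r*μ)/S) = (μ + δ*y)/S := by
      rw [eq_div_iff h1, add_mul, mul_assoc, div_mul_cancel₀ _ h1, ← hS]; ring
    rw [this]
    field_simp
  have em2 : m r = (y-r*μ)/(1+r*δ) := rfl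
  rw [em, ← em2]
  simp only [hp'def, hpdef, Function.comp]
  ring

lemma aux_jensen (φ : ℝ → ℝ) (hφ : Measurable φ) :
    ‖∫ r in (0:ℝ)..1, φ r‖ₑ ^ 2 ≤ ∫⁻ r in Set.Ioc (0:ℝ) 1, ‖φ r‖ₑ ^ 2 := by
  have : IsProbabilityMeasure (volume.restrict (Set.Ioc (0:ℝ) 1)) := ⟨by simp⟩
  rw [intervalIntegral.integral_of_le zero_le_one]
  have h1 : ‖∫ r in Set.Ioc (0:ℝ) 1, φ r‖ₑ ≤ eLpNorm φ 1 (volume.restrict (Set.Ioc (0:ℝ) 1)) := by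
    rw [eLpNorm_one_eq_lintegral_enorm]
    exact enorm_integral_le_lintegral_enorm _
  have h2 : eLpNorm φ 1 (volume.restrict (Set.Ioc (0:ℝ) 1)) ≤
      eLpNorm φ 2 (volume.restrict (Set.Ioc (0:ℝ) 1)) :=
    eLpNorm_le_eLpNorm_of_exponent_le (by norm_num) hφ.aestronglyMeasurable
  have h3 := eLpNorm_nnreal_pow_eq_lintegral (f := φ) (μ := volume.restrict (Set.Ioc (0:ℝ) 1))
    (p := 2) (by norm_num)
  norm_num at h3
  rw [← h3]
  gcongr
  exact h1.trans h2

lemma aux_scale (G : ℝ → ENNReal) (a b : ℝ) (hb : 0 < b) :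
    ∫⁻ y, ENNReal.ofReal b⁻¹ * G ((y-a)/b) = ∫⁻ x, G x := by
  have hd : ∀ x ∈ (Set.univ : Set ℝ), HasDerivWithinAt (fun y : ℝ => (y-a)/b) b⁻¹ Set.univ x := by
    intro x _
    have h1 := ((hasDerivAt_id x).sub_const a).div_const b
    rw [one_div] at h1
    exact h1.hasDerivWithinAt
  have := lintegral_image_eq_lintegral_abs_deriv_mul MeasurableSet.univ hd
    (fun x _ y _ hxy => by
      have h : (x-a)/b = (y-a)/b := hxy
      rw [div_left_inj' hb.ne'] at h
      linarith) G
  have himg : (fun y : ℝ => (y-a)/b) '' Set.univ = Set.univ := by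
    rw [Set.image_univ, Set.range_eq_univ]
    intro x
    exact ⟨b*x+a, by field_simp; ring⟩
  rw [himg, abs_of_pos (inv_pos.2 hb)] at this
  simpa using this.symm

lemma aux_bound (s h : ℝ → ℝ) (hsm : Measurable s) (hhm : Measurable h)
    (hhl : LocallyIntegrable h)
    (hs : ∀ a b : ℝ, s b - s a = ∫ y in a..b, h y) (μ δ : ℝ) (hδ : |δ| < 1) :
    ∫⁻ y, ‖(√(1+δ))⁻¹ * s ((y-μ)/(1+δ)) - s y‖ₑ ^ 2 ≤
      ENNReal.ofReal ((1-|δ|)⁻¹ ^ 2) * ∫⁻ y, ‖μ * h y + δ * (s y / 2 + y * h y)‖ₑ ^ 2 := by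
  set w : ℝ → ℝ := fun y => μ * h y + δ * (s y / 2 + y * h y) with hw
  have hwm : Measurable w := by fun_prop
  have hm2 : Measurable (fun q : ℝ × ℝ =>
      -((1+q.2*δ)⁻¹ * (√(1+q.2*δ))⁻¹ * w ((q.1-q.2*μ)/(1+q.2*δ)))) := by fun_prop
  calc ∫⁻ y, ‖(√(1+δ))⁻¹ * s ((y-μ)/(1+δ)) - s y‖ₑ ^ 2
      ≤ ∫⁻ y, ∫⁻ r in Set.Ioc (0:ℝ) 1,
          ‖-((1+r*δ)⁻¹ * (√(1+r*δ))⁻¹ * w ((y-r*μ)/(1+r*δ)))‖ₑ ^ 2 := by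
        apply lintegral_mono
        intro y
        dsimp only
        rw [aux_path s h hhl hs μ δ y hδ]
        exact aux_jensen _ (hm2.comp (by fun_prop : Measurable fun r : ℝ => (y, r)))
    _ = ∫⁻ r in Set.Ioc (0:ℝ) 1, ∫⁻ y,
          ‖-((1+r*δ)⁻¹ * (√(1+r*δ))⁻¹ * w ((y-r*μ)/(1+r*δ)))‖ₑ ^ 2 := by
        rw [lintegral_lintegral_swap]
        exact (hm2.enorm.pow_const 2).aemeasurable
    _ ≤ ∫⁻ r in Set.Ioc (0:ℝ) 1, ENNReal.ofReal ((1-|δ|)⁻¹ ^ 2) * ∫⁻ y, ‖w y‖ₑ ^ 2 := by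
        apply setLIntegral_mono' measurableSet_Ioc
        intro r hr
        have h1 := aux_pos (δ := δ) (Set.Ioc_subset_Icc_self hr)
        have h2 : 0 < 1 - |δ| := by linarith
        have h3 : 0 < 1 + r*δ := by linarith
        rw [← aux_scale (fun x => ‖w x‖ₑ ^ 2) (r*μ) (1+r*δ) h3,
          ← lintegral_const_mul' _ _ ENNReal.ofReal_ne_top]
        apply lintegral_mono
        intro y
        dsimp only
        rw [enorm_neg, enorm_mul, enorm_mul, mul_pow, mul_pow, ← mul_assoc]
        gcongr ?_ * _
        rw [Real.enorm_eq_ofReal (by positivity), Real.enorm_eq_ofReal (by positivity),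
          ← ENNReal.ofReal_pow (by positivity), ← ENNReal.ofReal_pow (by positivity),
          inv_pow (√_), Real.sq_sqrt h3.le]
        gcongr
    _ = ENNReal.ofReal ((1-|δ|)⁻¹ ^ 2) * ∫⁻ y, ‖w y‖ₑ ^ 2 := by simp

lemma aux_bound_real (s h : ℝ → ℝ) (hsm : Measurable s) (hhm : Measurable h)
    (hhl : LocallyIntegrable h)
    (hs : ∀ a b : ℝ, s b - s a = ∫ y in a..b, h y) (μ δ : ℝ) (hδ : |δ| < 1)
    (hwi : Integrable fun y => (μ * h y + δ * (s y / 2 + y * h y))^2) :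
    Integrable (fun y => ((√(1+δ))⁻¹ * s ((y-μ)/(1+δ)) - s y)^2) ∧
    ∫ y, ((√(1+δ))⁻¹ * s ((y-μ)/(1+δ)) - s y)^2 ≤
      (1-|δ|)⁻¹ ^ 2 * ∫ y, (μ * h y + δ * (s y / 2 + y * h y))^2 := by
  have hb := aux_bound s h hsm hhm hhl hs μ δ hδ
  have hconv : ∀ x : ℝ, ‖x‖ₑ^2 = ENNReal.ofReal (x^2) := fun x => by
    rw [← enorm_pow, Real.enorm_eq_ofReal (sq_nonneg _)]
  simp_rw [hconv] at hb
  rw [← ofReal_integral_eq_lintegral_ofReal hwi (Eventually.of_forall fun y => sq_nonneg _),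
    ← ENNReal.ofReal_mul (by positivity)] at hb
  have hm : Measurable (fun y => ((√(1+δ))⁻¹ * s ((y-μ)/(1+δ)) - s y)^2) := by fun_prop
  have hi : Integrable (fun y => ((√(1+δ))⁻¹ * s ((y-μ)/(1+δ)) - s y)^2) := by
    refine ⟨hm.aestronglyMeasurable, ?_⟩
    rw [hasFiniteIntegral_iff_ofReal (Eventually.of_forall fun y => sq_nonneg _)]
    exact hb.trans_lt ENNReal.ofReal_lt_top
  refine ⟨hi, ?_⟩
  rw [← ofReal_integral_eq_lintegral_ofReal hi (Eventually.of_forall fun y => sq_nonneg _)] at hb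
  refine (ENNReal.ofReal_le_ofReal_iff ?_).1 hb
  exact mul_nonneg (by positivity) (integral_nonneg fun y => sq_nonneg _)

lemma aux_pointwise (s : ℝ → ℝ) (d y : ℝ) (hd : HasDerivAt s d y) :
    (fun θ : ℝ × ℝ => (√θ.2)⁻¹ * s ((y - θ.1)/θ.2) - s y + (θ.1 * d + (θ.2 - 1) * (s y / 2 + y * d)))
      =o[𝓝 ((0:ℝ),(1:ℝ))] (fun θ : ℝ × ℝ => ‖θ - ((0:ℝ),(1:ℝ))‖) := by
  have hf : HasFDerivAt (fun θ : ℝ × ℝ => θ.1) (ContinuousLinearMap.fst ℝ ℝ ℝ) ((0:ℝ),(1:ℝ)) :=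
    hasFDerivAt_fst
  have hsn : HasFDerivAt (fun θ : ℝ × ℝ => θ.2) (ContinuousLinearMap.snd ℝ ℝ ℝ) ((0:ℝ),(1:ℝ)) :=
    hasFDerivAt_snd
  have hinv := (hasDerivAt_inv (one_ne_zero (α := ℝ))).comp_hasFDerivAt ((0:ℝ),(1:ℝ)) hsn
  have hm := (hf.const_sub y).mul hinv
  have hd' : HasDerivAt s d ((y - ((0:ℝ),(1:ℝ)).1) * (((fun x : ℝ => x⁻¹) ∘ fun θ : ℝ × ℝ => θ.2) ((0:ℝ),(1:ℝ)))) := by simpa using hd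
  have hsm := hd'.comp_hasFDerivAt ((0:ℝ),(1:ℝ)) hm
  have hq : HasDerivAt (fun x : ℝ => (√x)⁻¹) (-(1/2)) 1 := by
    have := ((hasDerivAt_id (1:ℝ)).sqrt one_ne_zero).inv (by simp)
    refine (this.congr_deriv ?_)
    simp
  have hp := hq.comp_hasFDerivAt ((0:ℝ),(1:ℝ)) hsn
  have hall := (hp.mul hsm).isLittleO
  refine (hall.congr_left ?_).norm_right
  intro θ
  simp [div_eq_mul_inv]
  ring

lemma aux_core (s h : ℝ → ℝ) (hsm : Measurable s) (hhm : Measurable h)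
    (hhl : LocallyIntegrable h)
    (hs : ∀ a b : ℝ, s b - s a = ∫ y in a..b, h y)
    (hd : ∀ᵐ y : ℝ, HasDerivAt s (h y) y)
    (hhi : Integrable fun y => (h y)^2) (hki : Integrable fun y => (s y / 2 + y * h y)^2) :
    (fun θ : ℝ × ℝ => √(∫ y, ((√θ.2)⁻¹ * s ((y - θ.1)/θ.2) - s y +
        (θ.1 * h y + (θ.2 - 1) * (s y / 2 + y * h y)))^2))
      =o[𝓝 ((0:ℝ),(1:ℝ))] (fun θ : ℝ × ℝ => ‖θ - ((0:ℝ),(1:ℝ))‖) := by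
  set k : ℝ → ℝ := fun y => s y / 2 + y * h y with hk
  have hkm : Measurable k := by fun_prop
  set N : ℝ × ℝ → ℝ := fun θ => ‖θ - ((0:ℝ),(1:ℝ))‖ with hN
  set A : ℝ × ℝ → ℝ → ℝ := fun θ y => (√θ.2)⁻¹ * s ((y - θ.1)/θ.2) - s y with hA
  set w : ℝ × ℝ → ℝ → ℝ := fun θ y => θ.1 * h y + (θ.2 - 1) * k y with hw
  set H : ℝ → ℝ := fun y => 2 * (h y)^2 + 2 * (k y)^2 with hH
  set P : ℝ × ℝ → ℝ → ℝ := fun θ y =>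
    max 0 (4 * (w θ y / N θ)^2 - ((A θ y - w θ y) / N θ)^2) with hP
  have hNn : ∀ θ, 0 ≤ N θ := fun θ => norm_nonneg _
  have hAm : ∀ θ, Measurable (A θ) := fun θ => by simp only [hA]; fun_prop
  have hwm : ∀ θ, Measurable (w θ) := fun θ => by simp only [hw]; fun_prop
  have hPm : ∀ θ, Measurable (P θ) := fun θ => by
    have := hAm θ
    have := hwm θ
    simp only [hP]; fun_prop
  have hHi : Integrable H := (hhi.const_mul 2).add (hki.const_mul 2)
  have hH0 : ∀ y, 0 ≤ H y := fun y => by simp only [hH]; positivity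
  have hwH : ∀ θ y, (w θ y)^2 ≤ (N θ)^2 * H y := by
    intro θ y
    have h1 : |θ.1| ≤ N θ := by simpa using norm_fst_le (θ - ((0:ℝ),(1:ℝ)))
    have h2 : |θ.2 - 1| ≤ N θ := by simpa using norm_snd_le (θ - ((0:ℝ),(1:ℝ)))
    have h3 : θ.1^2 ≤ (N θ)^2 := sq_le_sq.2 (by rwa [abs_of_nonneg (hNn θ)])
    have h4 : (θ.2-1)^2 ≤ (N θ)^2 := sq_le_sq.2 (by rwa [abs_of_nonneg (hNn θ)])
    simp only [hw, hH]
    nlinarith [sq_nonneg (θ.1 * h y - (θ.2 - 1) * k y),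
      mul_le_mul_of_nonneg_right h3 (sq_nonneg (h y)),
      mul_le_mul_of_nonneg_right h4 (sq_nonneg (k y))]
  have hwN : ∀ θ y, (w θ y / N θ)^2 ≤ H y := by
    intro θ y
    rcases (hNn θ).eq_or_lt with h0 | h0
    · rw [← h0]; simpa using hH0 y
    · rw [div_pow, div_le_iff₀ (by positivity), mul_comm]
      exact hwH θ y
  have hP0 : ∀ θ y, 0 ≤ P θ y := fun θ y => le_max_left _ _
  have hPH : ∀ θ y, P θ y ≤ 4 * H y := fun θ y =>
    max_le (by linarith [hH0 y]) (by nlinarith [hwN θ y, sq_nonneg ((A θ y - w θ y) / N θ)])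
  have hPi : ∀ θ, Integrable (P θ) := fun θ =>
    (hHi.const_mul 4).mono' (hPm θ).aestronglyMeasurable
      (Eventually.of_forall fun y => by rw [Real.norm_eq_abs, abs_of_nonneg (hP0 θ y)]; exact hPH θ y)
  have hwi : ∀ θ, Integrable (fun y => (w θ y)^2) := fun θ =>
    (hHi.const_mul ((N θ)^2)).mono' ((hwm θ).pow_const 2).aestronglyMeasurable
      (Eventually.of_forall fun y => by
        rw [Real.norm_eq_abs, abs_of_nonneg (sq_nonneg _)]; exact hwH θ y)
  have hPt : Tendsto (fun θ => ∫ y, P θ y) (𝓝 ((0:ℝ),(1:ℝ))) (𝓝 0) := by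
    have : Tendsto (fun θ => ∫ y, P θ y) (𝓝 ((0:ℝ),(1:ℝ))) (𝓝 (∫ _ : ℝ, (0:ℝ))) := by
      refine tendsto_integral_filter_of_dominated_convergence (fun y => 4 * H y) ?_ ?_ ?_ ?_
      · exact Eventually.of_forall fun θ => (hPm θ).aestronglyMeasurable
      · exact Eventually.of_forall fun θ => Eventually.of_forall fun y => by
          rw [Real.norm_eq_abs, abs_of_nonneg (hP0 θ y)]; exact hPH θ y
      · exact hHi.const_mul 4
      · filter_upwards [hd] with y hy
        have h1 := (aux_pointwise s (h y) y hy).tendsto_div_nhds_zero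
        have h2 : Tendsto (fun θ : ℝ × ℝ => 4 * √(H y) * |(A θ y + w θ y) / N θ|)
            (𝓝 ((0:ℝ),(1:ℝ))) (𝓝 0) := by
          simpa using (h1.abs).const_mul (4 * √(H y))
        refine squeeze_zero (fun θ => hP0 θ y) (fun θ => ?_) h2
        refine max_le (by positivity) ?_
        have h3 : |w θ y / N θ| ≤ √(H y) := Real.abs_le_sqrt (hwN θ y)
        have h4 : 4 * (w θ y / N θ)^2 - ((A θ y - w θ y) / N θ)^2 =
            4 * (w θ y / N θ) * ((A θ y + w θ y) / N θ) - ((A θ y + w θ y) / N θ)^2 := by ring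
        rw [h4]
        have h5 : (w θ y / N θ) * ((A θ y + w θ y) / N θ) ≤ √(H y) * |(A θ y + w θ y) / N θ| :=
          (le_abs_self _).trans (by rw [abs_mul]; gcongr)
        nlinarith [sq_nonneg ((A θ y + w θ y) / N θ)]
    simpa using this
  have hmain : ∀ᶠ θ in 𝓝 ((0:ℝ),(1:ℝ)), ∫ y, (A θ y + w θ y)^2 ≤
      (N θ)^2 * (2 * ((1-|θ.2-1|)⁻¹ ^ 2 - 1) * (∫ y, H y) + ∫ y, P θ y) := by
    have hev : ∀ᶠ θ : ℝ × ℝ in 𝓝 ((0:ℝ),(1:ℝ)), |θ.2 - 1| < 1 := by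
      have : ContinuousAt (fun θ : ℝ × ℝ => |θ.2 - 1|) ((0:ℝ),(1:ℝ)) := by fun_prop
      exact this.eventually_lt continuousAt_const (by simp)
    filter_upwards [hev] with θ hθ
    obtain ⟨hAi, hAb⟩ := aux_bound_real s h hsm hhm hhl hs θ.1 (θ.2-1) hθ (hwi θ)
    rw [show 1 + (θ.2 - 1) = θ.2 by ring] at hAi hAb
    change Integrable (fun y => (A θ y)^2) at hAi
    change ∫ y, (A θ y)^2 ≤ (1-|θ.2-1|)⁻¹ ^ 2 * ∫ y, (w θ y)^2 at hAb
    have hpt : ∀ y, (A θ y + w θ y)^2 ≤ 2 * (A θ y)^2 - 2 * (w θ y)^2 + (N θ)^2 * P θ y := by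
      intro y
      rcases (hNn θ).eq_or_lt with h0 | h0
      · have hθ1 : θ = ((0:ℝ),(1:ℝ)) := sub_eq_zero.1 (norm_eq_zero.1 h0.symm)
        rw [← h0]
        simp [hθ1, hA, hw]
      · have h1 : 4 * (w θ y / N θ)^2 - ((A θ y - w θ y) / N θ)^2 ≤ P θ y := le_max_right _ _
        have h2 : (N θ)^2 * (4 * (w θ y / N θ)^2 - ((A θ y - w θ y) / N θ)^2) =
            4 * (w θ y)^2 - (A θ y - w θ y)^2 := by field_simp
        have h3 := mul_le_mul_of_nonneg_left h1 (sq_nonneg (N θ))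
        rw [h2] at h3
        nlinarith
    have hI := integral_mono_of_nonneg (Eventually.of_forall fun y => sq_nonneg (A θ y + w θ y))
      (((hAi.const_mul 2).sub ((hwi θ).const_mul 2)).add ((hPi θ).const_mul ((N θ)^2)))
      (Eventually.of_forall hpt)
    have hI2 : ∫ y, (2 * (A θ y)^2 - 2 * (w θ y)^2 + (N θ)^2 * P θ y) =
        2 * (∫ y, (A θ y)^2) - 2 * (∫ y, (w θ y)^2) + (N θ)^2 * ∫ y, P θ y := by
      have hsub : Integrable (fun y => 2 * (A θ y)^2 - 2 * (w θ y)^2) :=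
        (hAi.const_mul 2).sub ((hwi θ).const_mul 2)
      rw [integral_add hsub ((hPi θ).const_mul _),
        integral_sub (hAi.const_mul 2) ((hwi θ).const_mul 2), integral_const_mul,
        integral_const_mul, integral_const_mul]
    have hI3 : ∫ y, (w θ y)^2 ≤ (N θ)^2 * ∫ y, H y := by
      rw [← integral_const_mul]
      exact integral_mono (hwi θ) (hHi.const_mul _) (hwH θ)
    have hc : 0 ≤ (1-|θ.2-1|)⁻¹ ^ 2 - 1 := by
      have h1 : 0 < 1 - |θ.2-1| := by linarith
      have : 1 ≤ (1-|θ.2-1|)⁻¹ := (one_le_inv₀ h1).2 (by linarith [abs_nonneg (θ.2-1)])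
      nlinarith
    have hI4 := mul_le_mul_of_nonneg_left hI3 hc
    refine hI.trans ?_
    have : (∫ y, ((fun y => 2 * (A θ y)^2) - (fun y => 2 * (w θ y)^2) + fun y => (N θ)^2 * P θ y : ℝ → ℝ) y)
      = 2 * (∫ y, (A θ y)^2) - 2 * (∫ y, (w θ y)^2) + (N θ)^2 * ∫ y, P θ y := hI2
    refine this.le.trans ?_
    nlinarith
  have hεt : Tendsto (fun θ : ℝ × ℝ => 2 * ((1-|θ.2-1|)⁻¹ ^ 2 - 1) * (∫ y, H y) + ∫ y, P θ y)
      (𝓝 ((0:ℝ),(1:ℝ))) (𝓝 0) := by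
    have h1 : ContinuousAt (fun θ : ℝ × ℝ => 2 * ((1-|θ.2-1|)⁻¹ ^ 2 - 1) * (∫ y, H y)) ((0:ℝ),(1:ℝ)) := by
      have : ContinuousAt (fun θ : ℝ × ℝ => (1-|θ.2-1|)⁻¹) ((0:ℝ),(1:ℝ)) :=
        ContinuousAt.inv₀ (by fun_prop) (by simp)
      fun_prop
    have h2 := h1.tendsto.add hPt
    simpa using h2
  rw [isLittleO_iff]
  intro c hc
  filter_upwards [hmain, hεt.eventually_lt_const (show (0:ℝ) < c^2 by positivity)] with θ h1 h2
  rw [Real.norm_eq_abs, abs_of_nonneg (Real.sqrt_nonneg _), norm_norm]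
  change √(∫ y, (A θ y + w θ y)^2) ≤ c * N θ
  apply Real.sqrt_le_iff.2 ⟨mul_nonneg hc.le (hNn θ), ?_⟩
  have := mul_le_mul_of_nonneg_left h2.le (sq_nonneg (N θ))
  linarith [mul_pow c (N θ) 2]

/-- under conditions (i)–(v) on the density `g` and its a.e. derivative `ġ`,
the location-scale family of `g` is Hellinger differentiable at `(μ,σ) = (0,1)` with
Hellinger derivative `(ξ̇_{(0,1)_μ}, ξ̇_{(0,1)_σ})`. -/
theorem hellinger_differentiability_of_location_scale
    (g gdot : ℝ → ℝ) (hg_nonneg : ∀ y, 0 ≤ g y) (hg_int : ∫ y, g y = 1)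
    -- (i) `g` is absolutely continuous (with a.e. derivative `ġ`)
    (hAC : ∀ a b : ℝ, g b - g a = ∫ y in a..b, gdot y)
    -- (ii) `g` has almost-everywhere derivative `ġ`
    (hderiv : ∀ᵐ y : ℝ, HasDerivAt g (gdot y) y)
    -- (iii) `ξ̇_{(μ,1)_μ}` is square integrable and its squared `L²` norm is continuous at 0
    (hsq : ∀ μ : ℝ, Integrable (fun y => (xiMuLoc g gdot μ y) ^ 2))
    (hconv : Tendsto (fun μ => ∫ y, (xiMuLoc g gdot μ y) ^ 2) (𝓝 0)
      (𝓝 (∫ y, (xiMuLoc g gdot 0 y) ^ 2)))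
    -- (iv) `y ξ̇_{(0,1)_μ}(y)` is square integrable
    (hysq : Integrable (fun y => (y * xiMuLoc g gdot 0 y) ^ 2))
    -- (v) `‖ξ̇_{(0,σ)_μ} - ξ̇_{(0,1)_μ}‖_{L²} = O(|σ-1|)` as `σ → 1`
    (hlip : (fun σ => l2norm (fun y => xiMuScale g gdot σ y - xiMuScale g gdot 1 y))
      =O[𝓝 (1 : ℝ)] (fun σ => |σ - 1|)) :
    HellingerDiffAt g (xiMuLoc g gdot 0) (xiSigma g gdot) := by
  have hgi : Integrable g := by
    by_contra h
    rw [integral_undef h] at hg_int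
    exact zero_ne_one hg_int
  have hae : gdot =ᵐ[volume] deriv g := by
    filter_upwards [hderiv] with y hy using hy.deriv.symm
  have hd : ∀ᵐ y : ℝ, DifferentiableAt ℝ g y := by
    filter_upwards [hderiv] with y hy using hy.differentiableAt
  have hgl : LocallyIntegrable (deriv g) :=
    (aux_locInt g gdot hg_int hAC).congr hae
  have hAC' : ∀ a b : ℝ, g b - g a = ∫ y in a..b, deriv g y := by
    intro a b
    rw [hAC a b]
    apply intervalIntegral.integral_congr_ae
    filter_upwards [hae] with y hy _ using hy
  have hgc : Continuous g := by
    have h1 : (fun x => g 0 + ∫ y in (0:ℝ)..x, deriv g y) = g := by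
      funext x; rw [← hAC']; ring
    have h2 : Continuous (fun x => g 0 + ∫ y in (0:ℝ)..x, deriv g y) :=
      continuous_const.add (intervalIntegral.continuous_primitive (aux_intInt hgl) 0)
    rwa [h1] at h2
  set s : ℝ → ℝ := fun y => √(g y) with hs
  set h : ℝ → ℝ := fun y => (1/2) * deriv g y * (if 0 < g y then 1 else 0) / √(g y) with hh
  have hsm : Measurable s := by fun_prop
  have hhm : Measurable h := by
    have h1 : Measurable (fun y => if 0 < g y then (1:ℝ) else 0) :=
      Measurable.ite (measurableSet_lt measurable_const hgc.measurable) measurable_const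
        measurable_const
    have h2 := measurable_deriv g
    exact ((h2.const_mul (1/2)).mul h1).div hsm
  have hxi : ∀ᵐ y : ℝ, xiMuLoc g gdot 0 y = - h y := by
    filter_upwards [hae] with y hy
    simp only [xiMuLoc, hh, sub_zero, hy]
    ring
  have hxs : ∀ᵐ y : ℝ, xiSigma g gdot y = -(s y / 2 + y * h y) := by
    filter_upwards [hae] with y hy
    simp only [xiSigma, hh, hs, hy]
    ring
  have hhi : Integrable (fun y => (h y)^2) := by
    refine (hsq 0).congr ?_
    filter_upwards [hxi] with y hy
    rw [hy]; ring
  have hyi : Integrable (fun y => (y * h y)^2) := by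
    refine hysq.congr ?_
    filter_upwards [hxi] with y hy
    rw [hy]; ring
  have hsi : Integrable (fun y => (s y)^2) := by
    refine hgi.congr (Eventually.of_forall fun y => ?_)
    exact (Real.sq_sqrt (hg_nonneg y)).symm
  have hki : Integrable (fun y => (s y / 2 + y * h y)^2) := by
    refine (hsi.add (hyi.const_mul 2)).mono' (by fun_prop) (Eventually.of_forall fun y => ?_)
    rw [Real.norm_eq_abs, abs_of_nonneg (sq_nonneg _)]
    simp only [Pi.add_apply]
    nlinarith [sq_nonneg (s y / 2 - y * h y), sq_nonneg (s y)]
  have hhl : LocallyIntegrable h :=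
    ((memLp_two_iff_integrable_sq hhm.aestronglyMeasurable).2 hhi).locallyIntegrable (by norm_num)
  have hftc : ∀ a b : ℝ, s b - s a = ∫ y in a..b, h y :=
    aux_sqrt_ftc g h hg_nonneg hgl hAC' hd (fun y => rfl) hhl
  have hsd : ∀ᵐ y : ℝ, HasDerivAt s (h y) y := by
    filter_upwards [LocallyIntegrable.ae_hasDerivAt_integral hhl] with y hy
    have h1 : s = fun x => s 0 + ∫ t in (0:ℝ)..x, h t := by
      funext x; rw [← hftc]; ring
    rw [h1]
    exact (hy 0).const_add (s 0)
  refine ⟨hsq 0, ?_, ?_⟩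
  · refine hki.congr ?_
    filter_upwards [hxs] with y hy
    rw [hy]; ring
  · refine (aux_core s h hsm hhm hhl hftc hsd hhi hki).congr_left (fun θ => ?_)
    unfold l2norm
    congr 1
    apply integral_congr_ae
    filter_upwards [hxi, hxs] with y hy1 hy2
    rw [hy1, hy2]
    simp only [locScale]
    rw [Real.sqrt_mul' _ (hg_nonneg _), Real.sqrt_inv]
    simp only [hs]
    ring
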